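/- Let M = (Q, Σ, δ, q₀, Q_f) be a DFA accepting a nonempty factorial and prolongable language L, in which all accepting states are reachable from q₀ and the complement of Q_f is a single absorbing state q̃. Then for every equivalence class [q] of accepting states under ↔ there is a word σ ∈ L such that for every state q' ∈ [q], the class [δ*(q', σ)] is ergodic or is equal to [q̃]. -/

import Mathlib

open Filter Topology MeasureTheory
open scoped Classical

section Defs

variable {A : Type*}

/-- The one-sided shift map on sequences. -/
def shiftSeq (s : ℕ → A) : ℕ → A := fun n => s (n + 1)

/-- The word consisting of the first `N` symbols of `s`. -/
def prefW (s : ℕ → A) (N : ℕ) : List A := (List.range N).map s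

/-- The cylinder of all sequences extending the word `σ`. -/
def cylSet (σ : List A) : Set (ℕ → A) := {s | prefW s σ.length = σ}

/-- `σ` occurs as a (contiguous) factor of the sequence `s`. -/
def isFactor (σ : List A) (s : ℕ → A) : Prop :=
  ∃ i : ℕ, σ = prefW (fun j => s (i + j)) σ.length

/-- The language of a subshift: all finite factors of its sequences. -/
def lang (X : Set (ℕ → A)) : Set (List A) := {σ | ∃ s ∈ X, isFactor σ s}

/-- Sequences all of whose prefixes lie in `L`. -/
def XL (L : Set (List A)) : Set (ℕ → A) := {s | ∀ N : ℕ, prefW s N ∈ L}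

/-- Number of occurrences of `τ` as a contiguous subword of `σ`. -/
def occ [DecidableEq A] (τ σ : List A) : ℕ :=
  ((List.range (σ.length + 1 - τ.length)).filter
    (fun i => decide ((σ.drop i).take τ.length = τ))).length

/-- The conditional probability `P([στ] | [σ])` (as a real number; junk value `0`
when `P([σ]) = 0`). -/
noncomputable def condP [MeasurableSpace A] (P : Measure (ℕ → A)) (σ τ : List A) : ℝ :=
  (P (cylSet (σ ++ τ))).toReal / (P (cylSet σ)).toReal

/-- `P` is `L`-supported: cylinders of positive measure are exactly those of words of `L`. -/
def SupportedOn [MeasurableSpace A] (P : Measure (ℕ → A)) (L : Set (List A)) : Prop :=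
  ∀ σ : List A, 0 < P (cylSet σ) ↔ σ ∈ L

/-- Shift-invariance of `P` (it suffices to check it on word cylinders). -/
def ShiftInvariant [MeasurableSpace A] (P : Measure (ℕ → A)) : Prop :=
  ∀ σ : List A, P (shiftSeq ⁻¹' cylSet σ) = P (cylSet σ)

/-- `P` is `k`-step Markov. -/
def MarkovK [MeasurableSpace A] (P : Measure (ℕ → A)) (k : ℕ) : Prop :=
  ∀ σ τ : List A, k ≤ σ.length → condP P σ τ = condP P (σ.drop (σ.length - k)) τ

/-- `Θ_k`: words of length `k` with positive measure. -/
def ThetaK [MeasurableSpace A] (P : Measure (ℕ → A)) (k : ℕ) : Set (List A) :=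
  {τ | τ.length = k ∧ 0 < P (cylSet τ)}

/-- Irreducibility of the transition matrix induced by `P` on `Θ_k`:
its positivity graph is strongly connected. -/
def IrreducibleK [MeasurableSpace A] (P : Measure (ℕ → A)) (k : ℕ) : Prop :=
  ∀ σ ∈ ThetaK P k, ∀ τ ∈ ThetaK P k,
    Relation.TransGen
      (fun x y => x ∈ ThetaK P k ∧ y ∈ ThetaK P k ∧ 0 < condP P x y) σ τ

/-- Irreducibility of the transition matrix of a 1-step Markov measure (restricted to
symbols of positive measure). -/
def Irreducible1 [MeasurableSpace A] (P : Measure (ℕ → A)) : Prop :=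
  ∀ a b : A, 0 < P (cylSet [a]) → 0 < P (cylSet [b]) →
    Relation.TransGen
      (fun x y : A => 0 < P (cylSet [x]) ∧ 0 < P (cylSet [y]) ∧ 0 < condP P [x] [y]) a b

/-- `s` is `P`-distributed. -/
def Distributed [MeasurableSpace A] [DecidableEq A] (P : Measure (ℕ → A)) (s : ℕ → A) : Prop :=
  ∀ σ : List A,
    Tendsto (fun N : ℕ => (occ σ (prefW s N) : ℝ) / N) atTop (𝓝 (P (cylSet σ)).toReal)

/-- `m_s(σ)`: lower asymptotic frequency of `σ` in `s`. -/
noncomputable def mLow [DecidableEq A] (s : ℕ → A) (σ : List A) : ℝ :=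
  liminf (fun N : ℕ => (occ σ (prefW s N) : ℝ) / N) atTop

/-- `M_s(σ)`: upper asymptotic frequency of `σ` in `s`. -/
noncomputable def mHigh [DecidableEq A] (s : ℕ → A) (σ : List A) : ℝ :=
  limsup (fun N : ℕ => (occ σ (prefW s N) : ℝ) / N) atTop

/-- A `P`-martingale on the language `L`. -/
def PMartingale [Fintype A] [MeasurableSpace A] (P : Measure (ℕ → A)) (L : Set (List A))
    (f : List A → ℝ) : Prop :=
  ∀ σ ∈ L, f σ = ∑ a : A, if σ ++ [a] ∈ L then condP P σ [a] * f (σ ++ [a]) else 0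

/-- A `P`-supermartingale on the language `L`. -/
def PSuperMartingale [Fintype A] [MeasurableSpace A] (P : Measure (ℕ → A)) (L : Set (List A))
    (f : List A → ℝ) : Prop :=
  ∀ σ ∈ L, f σ ≥ ∑ a : A, if σ ++ [a] ∈ L then condP P σ [a] * f (σ ++ [a]) else 0

/-- `f` succeeds on `s`: its values along prefixes of `s` are unbounded
(equivalently `limsup_N f(s↾N) = ∞`). -/
def SucceedsOn (f : List A → ℝ) (s : ℕ → A) : Prop :=
  ∀ C : ℝ, ∃ N : ℕ, C < f (prefW s N)

/-- `f` is generated by a DFA accepting `L`. -/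
def DFAGenerated (L : Set (List A)) (f : List A → ℝ) : Prop :=
  ∃ (Q : Type) (_ : Fintype Q) (d : Q → A → Q) (q₀ : Q) (F : Set Q) (b : Q → A → ℝ),
    (∀ σ : List A, σ ∈ L ↔ List.foldl d q₀ σ ∈ F) ∧
    (∀ (σ : List A) (a : A), σ ++ [a] ∈ L → f (σ ++ [a]) = b (List.foldl d q₀ σ) a * f σ)

/-- `L` is factorial: it contains all subwords of its words. -/
def FactorialLang (L : Set (List A)) : Prop := ∀ σ ∈ L, ∀ τ : List A, τ <:+: σ → τ ∈ L

/-- `L` is prolongable: every word of `L` has a nonempty extension in `L`. -/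
def ProlongableLang (L : Set (List A)) : Prop := ∀ σ ∈ L, ∃ τ : List A, τ ≠ [] ∧ σ ++ τ ∈ L

/-- State `q'` is reachable from `q` by reading some word of `L` (possibly empty). -/
def reaches {Q : Type*} (d : Q → A → Q) (L : Set (List A)) (q q' : Q) : Prop :=
  ∃ σ ∈ L, List.foldl d q σ = q'

/-- The `↔`-class of `q` is an ergodic class of accepting states: `q` is accepting and
every accepting state reachable from `q` can reach back to `q`. -/
def ErgodicSt {Q : Type*} (d : Q → A → Q) (L : Set (List A)) (F : Set Q) (q : Q) : Prop :=
  q ∈ F ∧ ∀ q' ∈ F, reaches d L q q' → reaches d L q' q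

end Defs

section AcceptingStates

variable {A Q : Type*} {L : Set (List A)} {d : Q → A → Q} {q₀ : Q} {F : Set Q}

/-- A word along which an accepting state leads to an accepting state belongs to `L`. -/
theorem mem_lang_of_foldl_mem (hfac : FactorialLang L)
    (hacc : ∀ σ : List A, σ ∈ L ↔ List.foldl d q₀ σ ∈ F)
    (hreach : ∀ q ∈ F, ∃ σ ∈ L, List.foldl d q₀ σ = q)
    {q : Q} (hq : q ∈ F) {τ : List A} (h : List.foldl d q τ ∈ F) : τ ∈ L := by
  obtain ⟨ρ, -, rfl⟩ := hreach q hq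
  rw [← List.foldl_append, ← hacc] at h
  exact hfac _ h _ (List.suffix_append ρ τ).isInfix

/-- Reachability composes, as long as the states involved are accepting. -/
theorem reaches_trans (hfac : FactorialLang L)
    (hacc : ∀ σ : List A, σ ∈ L ↔ List.foldl d q₀ σ ∈ F)
    (hreach : ∀ q ∈ F, ∃ σ ∈ L, List.foldl d q₀ σ = q)
    {p q r : Q} (hp : p ∈ F) (hr : r ∈ F) (hpq : reaches d L p q) (hqr : reaches d L q r) :
    reaches d L p r := by
  obtain ⟨σ, -, rfl⟩ := hpq
  obtain ⟨τ, -, rfl⟩ := hqr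
  rw [← List.foldl_append] at hr ⊢
  exact ⟨_, mem_lang_of_foldl_mem hfac hacc hreach hp hr, rfl⟩

/-- Every accepting state reaches an ergodic state. -/
theorem exists_reaches_ergodicSt [Finite Q] (hne : L.Nonempty) (hfac : FactorialLang L)
    (hacc : ∀ σ : List A, σ ∈ L ↔ List.foldl d q₀ σ ∈ F)
    (hreach : ∀ q ∈ F, ∃ σ ∈ L, List.foldl d q₀ σ = q)
    {p : Q} (hp : p ∈ F) : ∃ r, reaches d L p r ∧ ErgodicSt d L F r := by
  have hrefl : ∀ q, reaches d L q q := fun q =>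
    let ⟨σ, hσ⟩ := hne
    ⟨[], hfac σ hσ [] σ.nil_infix, rfl⟩
  obtain ⟨r, ⟨hpr, hr⟩, hmin⟩ := exists_minimalFor_of_wellFoundedLT
    (fun r => reaches d L p r ∧ r ∈ F) (fun r => {s | reaches d L r s ∧ s ∈ F}.ncard)
    ⟨p, hrefl p, hp⟩
  refine ⟨r, hpr, hr, fun s hs hrs => ?_⟩
  have hsub : {t | reaches d L s t ∧ t ∈ F} ⊆ {t | reaches d L r t ∧ t ∈ F} :=
    fun t ht => ⟨reaches_trans hfac hacc hreach hr ht.2 hrs ht.1, ht.2⟩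
  have hle := Set.ncard_le_ncard hsub (Set.toFinite _)
  have heq := Set.eq_of_subset_of_ncard_le hsub
    (hmin ⟨reaches_trans hfac hacc hreach hp hs hpr hrs, hs⟩ hle) (Set.toFinite _)
  have hmem : r ∈ {t | reaches d L r t ∧ t ∈ F} := ⟨hrefl r, hr⟩
  rw [← heq] at hmem
  exact hmem.1

/-- Accepting states reached from an ergodic state are ergodic. -/
theorem ErgodicSt.of_foldl_mem (hfac : FactorialLang L)
    (hacc : ∀ σ : List A, σ ∈ L ↔ List.foldl d q₀ σ ∈ F)
    (hreach : ∀ q ∈ F, ∃ σ ∈ L, List.foldl d q₀ σ = q)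
    {q : Q} (hq : ErgodicSt d L F q) {τ : List A} (h : List.foldl d q τ ∈ F) :
    ErgodicSt d L F (List.foldl d q τ) := by
  have hqτ : reaches d L q (List.foldl d q τ) :=
    ⟨τ, mem_lang_of_foldl_mem hfac hacc hreach hq.1 h, rfl⟩
  refine ⟨h, fun s hs hτs => ?_⟩
  have hqs := reaches_trans hfac hacc hreach hq.1 hs hqτ hτs
  exact reaches_trans hfac hacc hreach hs h (hq.2 s hs hqs) hqτ

/-- A single word of `L` leads every state of a finite set of accepting states out of `F` or to
an ergodic state. -/
theorem exists_word_forall_mem_ergodicSt [Finite Q] (hne : L.Nonempty) (hfac : FactorialLang L)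
    (hacc : ∀ σ : List A, σ ∈ L ↔ List.foldl d q₀ σ ∈ F)
    (hreach : ∀ q ∈ F, ∃ σ ∈ L, List.foldl d q₀ σ = q)
    (habs : ∀ q ∉ F, ∀ a, d q a ∉ F) (S : Finset Q) (hS : ∀ q ∈ S, q ∈ F) :
    ∃ σ ∈ L, ∀ q ∈ S, List.foldl d q σ ∉ F ∨ ErgodicSt d L F (List.foldl d q σ) := by
  have hout : ∀ (τ : List A) (q : Q), q ∉ F → List.foldl d q τ ∉ F := by
    intro τ
    induction τ with
    | nil => exact fun q hq => hq
    | cons a τ ih => exact fun q hq => ih _ (habs q hq a)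
  induction S using Finset.induction_on with
  | empty =>
    obtain ⟨σ, hσ⟩ := hne
    exact ⟨σ, hσ, by simp⟩
  | insert p S _ ih =>
    obtain ⟨σ, hσ, hgood⟩ := ih fun q hq => hS q (Finset.mem_insert_of_mem hq)
    by_cases hpσ : List.foldl d p σ ∈ F
    · obtain ⟨_, ⟨τ, -, rfl⟩, hr⟩ := exists_reaches_ergodicSt hne hfac hacc hreach hpσ
      rw [← List.foldl_append] at hr
      refine ⟨σ ++ τ, mem_lang_of_foldl_mem hfac hacc hreach
        (hS p (Finset.mem_insert_self p S)) hr.1, fun q hq => ?_⟩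
      rcases Finset.mem_insert.1 hq with rfl | hq
      · exact Or.inr hr
      · rw [List.foldl_append]
        by_cases hF : List.foldl d (List.foldl d q σ) τ ∈ F
        · refine Or.inr (ErgodicSt.of_foldl_mem hfac hacc hreach ?_ hF)
          exact (hgood q hq).resolve_left fun h => hout τ _ h hF
        · exact Or.inl hF
    · refine ⟨σ, hσ, fun q hq => ?_⟩
      rcases Finset.mem_insert.1 hq with rfl | hq
      · exact Or.inl hpσ
      · exact hgood q hq

end AcceptingStates

/-- For every class `[q]` of accepting states there is a word `σ ∈ L` leading every state
of `[q]` either to the garbage state or into an ergodic class. -/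
theorem statement9 {A : Type*} [Fintype A]
    (L : Set (List A)) (hne : L.Nonempty) (hfac : FactorialLang L) (hpro : ProlongableLang L)
    (Q : Type*) [Fintype Q] (d : Q → A → Q) (q₀ : Q) (F : Set Q)
    (hacc : ∀ σ : List A, σ ∈ L ↔ List.foldl d q₀ σ ∈ F)
    (hreach : ∀ q ∈ F, ∃ σ ∈ L, List.foldl d q₀ σ = q)
    (qt : Q) (hqt : qt ∉ F) (hqtonly : ∀ q, q ∉ F → q = qt)
    (habs : ∀ a : A, d qt a = qt) :
    ∀ q ∈ F, ∃ σ ∈ L, ∀ q' : Q, (reaches d L q q' ∧ reaches d L q' q) →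
      List.foldl d q' σ = qt ∨ ErgodicSt d L F (List.foldl d q' σ) := by
  intro q _
  obtain ⟨σ, hσ, hgood⟩ := exists_word_forall_mem_ergodicSt hne hfac hacc hreach
    (fun p hp a => by rw [hqtonly p hp, habs]; exact hqt) (Finset.univ.filter (· ∈ F))
    (fun p hp => (Finset.mem_filter.1 hp).2)
  refine ⟨σ, hσ, fun p hp => ?_⟩
  by_cases hpF : p ∈ F
  · exact (hgood p (Finset.mem_filter.2 ⟨Finset.mem_univ p, hpF⟩)).imp_left (hqtonly _)
  · left
    rw [hqtonly p hpF]
    exact List.foldl_fixed' habs σ
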